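/- For r ≡ 5 (mod 8), the centralizer of spin(r) = span{e_i e_j : 1 ≤ i < j ≤ r} in the even Clifford algebra Cl_{r+2}^0 is the 4-dimensional span of 1, e_{r+1}e_{r+2}, e_1···e_{r+1}, and e_1···e_r e_{r+2}, which is isomorphic as an algebra to the quaternions ℍ. -/

import Mathlib

/-- The negative definite quadratic form on `ℝⁿ`. -/
noncomputable def Qneg (n : ℕ) : QuadraticForm ℝ (Fin n → ℝ) :=
  QuadraticMap.weightedSumSquares ℝ (fun _ : Fin n => (-1 : ℝ))

/-- The Clifford algebra `Cl_n` with `e_j e_k + e_k e_j = -2 δ_{jk}`. -/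
noncomputable abbrev Cl (n : ℕ) := CliffordAlgebra (Qneg n)

/-- The standard generators `e_i` of `Cl_n`. -/
noncomputable def gen (n : ℕ) (i : Fin n) : Cl n :=
  CliffordAlgebra.ι (Qneg n) (Pi.single i 1)

/-- For an index set `I = {i₁ < ⋯ < i_s}`, the basis element `e_I = e_{i₁} ⋯ e_{i_s}`. -/
noncomputable def eProd (n : ℕ) (I : Finset (Fin n)) : Cl n :=
  ((I.sort (· ≤ ·)).map (gen n)).prod


/-- Product of generators along a list. -/
noncomputable def lP (n : ℕ) (L : List (Fin n)) : Cl n := (L.map (gen n)).prod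

theorem lP_nil (n : ℕ) : lP n [] = 1 := by simp [lP]

theorem lP_cons (n : ℕ) (i : Fin n) (L : List (Fin n)) : lP n (i :: L) = gen n i * lP n L := by
  simp [lP]

theorem lP_append (n : ℕ) (K L : List (Fin n)) : lP n (K ++ L) = lP n K * lP n L := by
  simp [lP]

theorem gen_sq (n : ℕ) (i : Fin n) : gen n i * gen n i = -1 := by
  have h : (Qneg n) (Pi.single i 1) = -1 := by
    simp [Qneg, QuadraticMap.weightedSumSquares_apply, Pi.single_apply]
  rw [gen, CliffordAlgebra.ι_sq_scalar, h]
  simp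

theorem gen_anti (n : ℕ) (i j : Fin n) (h : i ≠ j) :
    gen n i * gen n j = -(gen n j * gen n i) := by
  apply CliffordAlgebra.ι_mul_ι_comm_of_isOrtho
  rw [QuadraticMap.isOrtho_def]
  simp only [Qneg, QuadraticMap.weightedSumSquares_apply, ← Finset.sum_add_distrib]
  refine Finset.sum_congr rfl fun k _ => ?_
  by_cases h1 : k = i
  · subst h1; simp [h]
  · simp [Pi.single_apply, h1]

theorem gen_mul_lP (n : ℕ) (i : Fin n) (L : List (Fin n)) :
    gen n i * lP n L = (-1 : ℝ) ^ (L.length + L.count i) • (lP n L * gen n i) := by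
  induction L with
  | nil => simp [lP_nil]
  | cons j L ih =>
    rw [lP_cons]
    by_cases h : i = j
    · subst h
      nth_rewrite 1 [ih]
      rw [mul_smul_comm, ← mul_assoc]
      congr 1
      simp only [List.length_cons, List.count_cons_self]
      ring
    · rw [← mul_assoc, gen_anti n i j h, neg_mul, mul_assoc, ih, mul_smul_comm, ← mul_assoc,
        List.count_cons_of_ne (Ne.symm h), List.length_cons]
      rw [show L.length + 1 + L.count i = L.length + L.count i + 1 by ring, pow_succ]
      simp

theorem gen2_mul_lP (n : ℕ) (i j : Fin n) (L : List (Fin n)) :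
    gen n i * gen n j * lP n L
      = (-1 : ℝ) ^ (L.count i + L.count j) • (lP n L * (gen n i * gen n j)) := by
  rw [mul_assoc, gen_mul_lP, mul_smul_comm, ← mul_assoc, gen_mul_lP, smul_mul_assoc, smul_smul,
    mul_assoc, ← pow_add]
  congr 1
  rw [show L.length + L.count j + (L.length + L.count i)
    = (L.length + L.length) + (L.count i + L.count j) by ring, pow_add, Even.neg_one_pow ⟨_, rfl⟩,
    one_mul]

theorem gen2_sq (n : ℕ) (i j : Fin n) (h : i ≠ j) :
    (gen n i * gen n j) * (gen n i * gen n j) = -1 := by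
  have : gen n i * gen n j * (gen n i * gen n j)
      = gen n i * (gen n j * gen n i) * gen n j := by noncomm_ring
  rw [this, gen_anti n j i (Ne.symm h)]
  have : gen n i * -(gen n i * gen n j) * gen n j
    = - ((gen n i * gen n i) * (gen n j * gen n j)) := by noncomm_ring
  rw [this, gen_sq, gen_sq]; simp

theorem lP_sq (n : ℕ) (L : List (Fin n)) (h : L.Nodup) :
    lP n L * lP n L = (-1 : ℝ) ^ ((L.length + 1).choose 2) • (1 : Cl n) := by
  induction L with
  | nil => simp [lP_nil]
  | cons j L ih =>
    rw [List.nodup_cons] at h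
    have ih := ih h.2
    have hc : L.count j = 0 := List.count_eq_zero_of_not_mem h.1
    have e : lP n (j :: L) * lP n (j :: L) = gen n j * lP n L * gen n j * lP n L := by
      rw [lP_cons]; noncomm_ring
    have e2 := gen_mul_lP n j L
    have e3 : lP n L * gen n j = (-1 : ℝ) ^ L.length • (gen n j * lP n L) := by
      rw [e2, hc, smul_smul, ← pow_add]; simp
    rw [e, mul_assoc (gen n j), e3, mul_smul_comm, ← mul_assoc, gen_sq, smul_mul_assoc,
      mul_assoc, ih, List.length_cons, Nat.choose_succ_succ' (L.length + 1) 1, pow_add,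
      Nat.choose_one_right, pow_succ]
    simp [smul_smul]

theorem involute_lP (n : ℕ) (L : List (Fin n)) :
    CliffordAlgebra.involute (lP n L) = (-1 : ℝ) ^ L.length • lP n L := by
  induction L with
  | nil => simp [lP_nil]
  | cons j L ih =>
    rw [lP_cons, map_mul, ih, gen, CliffordAlgebra.involute_ι, List.length_cons, pow_succ]
    simp

theorem lP_mem_even (n : ℕ) (L : List (Fin n)) (h : Even L.length) :
    lP n L ∈ CliffordAlgebra.even (Qneg n) := by
  have key : ∀ L : List (Fin n), lP n L ∈ CliffordAlgebra.evenOdd (Qneg n) (L.length : ZMod 2) := by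
    intro L
    induction L with
    | nil =>
      rw [lP_nil]
      exact CliffordAlgebra.one_le_evenOdd_zero _ (Submodule.one_le.1 le_rfl)
    | cons j L ih =>
      rw [lP_cons, List.length_cons, Nat.cast_add, add_comm, Nat.cast_one]
      exact SetLike.mul_mem_graded (CliffordAlgebra.ι_mem_evenOdd_one _ _) ih
  have := key L
  rw [(ZMod.natCast_eq_zero_iff_even).2 h] at this
  exact this

theorem gen_mul_sorted (n : ℕ) (i : Fin n) (L : List (Fin n)) (h : L.Pairwise (· < ·)) :
    ∃ K : List (Fin n), K.Pairwise (· < ·) ∧ (∀ k ∈ K, k = i ∨ k ∈ L) ∧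
      ∃ s : ℝ, gen n i * lP n L = s • lP n K := by
  induction L with
  | nil => exact ⟨[i], by simp, by simp, 1, by simp [lP_cons]⟩
  | cons j L ih =>
    rw [List.pairwise_cons] at h
    rcases lt_trichotomy i j with hij | hij | hij
    · refine ⟨i :: j :: L, ?_, by simp, 1, by simp [lP_cons]⟩
      rw [List.pairwise_cons]
      refine ⟨?_, List.pairwise_cons.2 h⟩
      intro k hk
      rcases List.mem_cons.1 hk with rfl | hk
      · exact hij
      · exact hij.trans (h.1 k hk)
    · subst hij
      refine ⟨L, h.2, fun k hk => Or.inr (List.mem_cons_of_mem _ hk), -1, ?_⟩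
      rw [lP_cons, ← mul_assoc, gen_sq]; simp
    · obtain ⟨K, hK, hm, s, hs⟩ := ih h.2
      refine ⟨j :: K, ?_, ?_, -s, ?_⟩
      · rw [List.pairwise_cons]
        refine ⟨?_, hK⟩
        intro k hk
        rcases hm k hk with rfl | hk
        · exact hij
        · exact h.1 k hk
      · intro k hk
        rcases List.mem_cons.1 hk with rfl | hk
        · simp
        · rcases hm k hk with h | h <;> simp [h]
      · rw [lP_cons, ← mul_assoc, gen_anti n i j hij.ne', neg_mul, mul_assoc, hs, lP_cons]
        simp

theorem ι_eq_sum (n : ℕ) (v : Fin n → ℝ) :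
    CliffordAlgebra.ι (Qneg n) v = ∑ i, v i • gen n i := by
  conv_lhs => rw [← Finset.univ_sum_single v]
  rw [map_sum]
  refine Finset.sum_congr rfl fun i _ => ?_
  rw [gen, ← map_smul, ← Pi.single_smul]
  simp

theorem mem_span_sorted (n : ℕ) (x : Cl n) :
    x ∈ Submodule.span ℝ (lP n '' {L | L.Pairwise (· < ·)}) := by
  set S := Submodule.span ℝ (lP n '' {L | L.Pairwise (· < ·)}) with hS
  have h1 : ∀ i, ∀ y ∈ S, gen n i * y ∈ S := by
    intro i y hy
    induction hy using Submodule.span_induction with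
    | mem y hy =>
      obtain ⟨L, hL, rfl⟩ := hy
      obtain ⟨K, hK, -, s, hs⟩ := gen_mul_sorted n i L hL
      rw [hs]
      exact S.smul_mem _ (Submodule.subset_span ⟨K, hK, rfl⟩)
    | zero => simp
    | add y z _ _ hy hz => rw [mul_add]; exact S.add_mem hy hz
    | smul c y _ hy => rw [mul_smul_comm]; exact S.smul_mem _ hy
  have h2 : ∀ x : Cl n, ∀ y ∈ S, x * y ∈ S := by
    intro x
    induction x using CliffordAlgebra.induction with
    | algebraMap c =>
      intro y hy
      rw [← Algebra.smul_def]; exact S.smul_mem _ hy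
    | ι v =>
      intro y hy
      rw [ι_eq_sum, Finset.sum_mul]
      refine S.sum_mem fun i _ => ?_
      rw [smul_mul_assoc]
      exact S.smul_mem _ (h1 i y hy)
    | mul a b ha hb =>
      intro y hy
      rw [mul_assoc]; exact ha _ (hb _ hy)
    | add a b ha hb =>
      intro y hy
      rw [add_mul]; exact S.add_mem (ha _ hy) (hb _ hy)
  have := h2 x 1 (Submodule.subset_span ⟨[], by simp, lP_nil n⟩)
  simpa using this

theorem filt {V α : Type*} [AddCommGroup V] [Module ℝ V] (P : α → V) (T : V →ₗ[ℝ] V)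
    (good : α → Prop) (S : Set α) (h1 : ∀ L, good L → T (P L) = P L)
    (h2 : ∀ L, ¬ good L → T (P L) = - P L) (x : V) (hx : x ∈ Submodule.span ℝ (P '' S))
    (hT : T x = x) : x ∈ Submodule.span ℝ (P '' {L | L ∈ S ∧ good L}) := by
  have key : ∀ y ∈ Submodule.span ℝ (P '' S),
      y + T y ∈ Submodule.span ℝ (P '' {L | L ∈ S ∧ good L}) := by
    intro y hy
    induction hy using Submodule.span_induction with
    | mem y hy =>
      obtain ⟨L, hL, rfl⟩ := hy
      by_cases h : good L
      · rw [h1 L h]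
        exact Submodule.add_mem _ (Submodule.subset_span ⟨L, ⟨hL, h⟩, rfl⟩)
          (Submodule.subset_span ⟨L, ⟨hL, h⟩, rfl⟩)
      · rw [h2 L h]; simp
    | zero => simp
    | add y z _ _ hy hz =>
      have := Submodule.add_mem _ hy hz
      rw [map_add]
      convert this using 1
      abel
    | smul c y _ hy => rw [map_smul, ← smul_add]; exact Submodule.smul_mem _ _ hy
  have := Submodule.smul_mem _ (2⁻¹ : ℝ) (key x hx)
  rw [hT, ← two_smul ℝ x, smul_smul] at this
  simpa using this

theorem filt_family {V α κ : Type*} [AddCommGroup V] [Module ℝ V] (P : α → V)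
    (T : κ → V →ₗ[ℝ] V)
    (good : κ → α → Prop) (S : Set α) (h1 : ∀ k L, good k L → T k (P L) = P L)
    (h2 : ∀ k L, ¬ good k L → T k (P L) = - P L) (x : V) (hx : x ∈ Submodule.span ℝ (P '' S))
    (hT : ∀ k, T k x = x) (l : Finset κ) :
    x ∈ Submodule.span ℝ (P '' {L | L ∈ S ∧ ∀ k ∈ l, good k L}) := by
  classical
  induction l using Finset.induction_on with
  | empty => simpa using hx
  | insert k l _ ih =>
    have := filt P (T k) (good k) _ (h1 k) (h2 k) x ih (hT k)
    refine Submodule.span_mono (Set.image_mono ?_) this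
    rintro L ⟨⟨hL, hl⟩, hk⟩
    refine ⟨hL, ?_⟩
    intro m hm
    rcases Finset.mem_insert.1 hm with rfl | hm
    · exact hk
    · exact hl m hm

theorem lP_eq_eProd (n : ℕ) (L : List (Fin n)) (h : L.Pairwise (· < ·)) :
    lP n L = eProd n L.toFinset := by
  have h1 : L.Nodup := h.imp fun h => ne_of_lt h
  rw [eProd, (List.toFinset_sort (· ≤ ·) h1).2 (h.imp fun h => le_of_lt h), lP]

theorem centralizer_sub (n r : ℕ) (x : Cl n) (hx : x ∈ CliffordAlgebra.even (Qneg n))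
    (hc : ∀ i j : Fin n, (i : ℕ) < r → (j : ℕ) < r → i < j →
          Commute x (gen n i * gen n j)) :
    x ∈ Submodule.span ℝ (lP n '' {L | (L.Pairwise (· < ·) ∧ Even L.length) ∧
      ∀ i j : Fin n, (i : ℕ) < r → (j : ℕ) < r → i < j → Even (L.count i + L.count j)}) := by
  have h0 := filt (lP n) (CliffordAlgebra.involute (Q := Qneg n)).toLinearMap
    (fun L => Even L.length) {L | L.Pairwise (· < ·)}
    (fun L hL => by simp [involute_lP, Even.neg_one_pow hL])
    (fun L hL => by simp [involute_lP, Odd.neg_one_pow (Nat.not_even_iff_odd.1 hL)])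
    x (mem_span_sorted n x) (CliffordAlgebra.involute_eq_of_mem_even hx)
  let κ := {p : Fin n × Fin n // (p.1 : ℕ) < r ∧ (p.2 : ℕ) < r ∧ p.1 < p.2}
  let g : κ → Cl n := fun k => gen n k.1.1 * gen n k.1.2
  have hg : ∀ k, g k * g k = -1 := fun k => gen2_sq n _ _ (ne_of_lt k.2.2.2)
  have h1 := filt_family (κ := κ) (lP n)
    (fun k => -((LinearMap.mulLeft ℝ (g k)).comp (LinearMap.mulRight ℝ (g k))))
    (fun k L => Even (L.count k.1.1 + L.count k.1.2)) _
    (fun k L hL => by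
      have := gen2_mul_lP n k.1.1 k.1.2 L
      rw [Even.neg_one_pow hL, one_smul] at this
      change -(g k * (lP n L * g k)) = _
      rw [← mul_assoc, show g k * lP n L = lP n L * g k from this, mul_assoc, hg]
      simp)
    (fun k L hL => by
      have := gen2_mul_lP n k.1.1 k.1.2 L
      rw [Odd.neg_one_pow (Nat.not_even_iff_odd.1 hL)] at this
      change -(g k * (lP n L * g k)) = _
      rw [← mul_assoc, show g k * lP n L = (-1 : ℝ) • (lP n L * g k) from this, smul_mul_assoc,
        mul_assoc, hg]
      simp)
    x h0 (fun k => by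
      change -(g k * (x * g k)) = _
      have := hc k.1.1 k.1.2 k.2.1 k.2.2.1 k.2.2.2
      rw [← mul_assoc, show g k * x = x * g k from this.eq.symm, mul_assoc, hg]
      simp) Finset.univ
  refine Submodule.span_mono (Set.image_mono ?_) h1
  rintro L ⟨hL, hk⟩
  exact ⟨hL, fun i j hi hj hij => hk ⟨(i, j), hi, hj, hij⟩ (Finset.mem_univ _)⟩

theorem sorted_ext (n : ℕ) (L K : List (Fin n)) (hL : L.Pairwise (· < ·))
    (hK : K.Pairwise (· < ·)) (h : ∀ k, k ∈ L ↔ k ∈ K) : L = K := by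
  have h1 : L.Nodup := hL.imp fun h => ne_of_lt h
  have h2 : K.Nodup := hK.imp fun h => ne_of_lt h
  rw [← (List.toFinset_sort (· ≤ ·) h1).2 (hL.imp fun h => le_of_lt h),
    ← (List.toFinset_sort (· ≤ ·) h2).2 (hK.imp fun h => le_of_lt h)]
  congr 1
  ext k
  simp [h k]

/-- The list of the first `r` indices. -/
def wL (r : ℕ) : List (Fin (r + 2)) := (List.finRange r).map (Fin.castLE (by omega))

theorem wL_len (r : ℕ) : (wL r).length = r := by simp [wL]

theorem wL_mem (r : ℕ) (i : Fin (r + 2)) : i ∈ wL r ↔ (i : ℕ) < r := by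
  simp only [wL, List.mem_map, List.mem_finRange, true_and]
  constructor
  · rintro ⟨k, rfl⟩; exact k.2
  · intro h; exact ⟨⟨i, h⟩, by ext; simp⟩

theorem wL_sorted (r : ℕ) : (wL r).Pairwise (· < ·) := by
  rw [wL, List.pairwise_map]
  exact (List.pairwise_lt_finRange r).imp fun h => h

theorem wL_append_sorted (r : ℕ) (l : List (Fin (r + 2))) (hl : l.Pairwise (· < ·))
    (h : ∀ k ∈ l, r ≤ (k : ℕ)) : (wL r ++ l).Pairwise (· < ·) := by
  rw [List.pairwise_append]
  refine ⟨wL_sorted r, hl, ?_⟩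
  intro i hi j hj
  have := (wL_mem r i).1 hi
  have := h j hj
  rw [Fin.lt_def]; omega

theorem classify (r : ℕ) (hr : Odd r) (p q : Fin (r + 2)) (hp : (p : ℕ) = r)
    (hq : (q : ℕ) = r + 1) (L : List (Fin (r + 2))) (hL : L.Pairwise (· < ·))
    (he : Even L.length)
    (hc : ∀ i j : Fin (r + 2), (i : ℕ) < r → (j : ℕ) < r → i < j →
      Even (L.count i + L.count j)) :
    L = [] ∨ L = [p, q] ∨ L = wL r ++ [p] ∨ L = wL r ++ [q] := by
  have hnd : L.Nodup := hL.imp fun h => ne_of_lt h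
  have hpq : p < q := by rw [Fin.lt_def]; simp [hp, hq]
  have hcnt : ∀ i j : Fin (r + 2), (i : ℕ) < r → (j : ℕ) < r → i < j → (i ∈ L ↔ j ∈ L) := by
    intro i j hi hj hij
    have := hc i j hi hj hij
    rw [List.Nodup.count hnd, List.Nodup.count hnd] at this
    by_cases h1 : i ∈ L <;> by_cases h2 : j ∈ L <;> simp_all
  have hcnt' : ∀ i j : Fin (r + 2), (i : ℕ) < r → (j : ℕ) < r → (i ∈ L ↔ j ∈ L) := by
    intro i j hi hj
    rcases lt_trichotomy i j with h | h | h
    · exact hcnt i j hi hj h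
    · rw [h]
    · exact (hcnt j i hj hi h).symm
  have hrpos : 0 < r := hr.pos
  let z : Fin (r + 2) := ⟨0, by omega⟩
  let T : List (Fin (r + 2)) :=
    (if p ∈ L then [p] else []) ++ (if q ∈ L then [q] else [])
  have hTs : T.Pairwise (· < ·) := by
    simp only [T]; split_ifs <;> simp [hpq]
  have hTm : ∀ k ∈ T, r ≤ (k : ℕ) := by
    intro k hk
    simp only [T, List.mem_append] at hk
    rcases hk with hk | hk
    · split_ifs at hk
      · simp at hk; simp [hk, hp]
      · simp at hk
    · split_ifs at hk
      · simp at hk; simp [hk, hq]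
      · simp at hk
  have hTm2 : ∀ k : Fin (r + 2), r ≤ (k : ℕ) → (k ∈ L ↔ k ∈ T) := by
    intro k hk
    have : k = p ∨ k = q := by
      have := k.2
      simp only [Fin.ext_iff, hp, hq]; omega
    rcases this with h | h
    · rw [h]
      by_cases h1 : p ∈ L <;> by_cases h2 : q ∈ L <;> simp [T, h1, h2, hpq.ne]
    · rw [h]
      by_cases h1 : p ∈ L <;> by_cases h2 : q ∈ L <;> simp [T, h1, h2, hpq.ne']
  by_cases hz : z ∈ L
  · have : L = wL r ++ T := by
      refine sorted_ext _ _ _ hL (wL_append_sorted r T hTs hTm) ?_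
      intro k
      rw [List.mem_append, wL_mem]
      by_cases hk : (k : ℕ) < r
      · simp only [hk, true_or, iff_true]
        exact (hcnt' k z hk hrpos).2 hz
      · simp only [hk, false_or]
        exact hTm2 k (by omega)
    have hlen : L.length = r + T.length := by rw [this, List.length_append, wL_len]
    by_cases h1 : p ∈ L <;> by_cases h2 : q ∈ L <;> simp only [T, h1, h2, if_true, if_false] at this hlen
    · exfalso; simp at hlen; grind
    · exact Or.inr (Or.inr (Or.inl (by simpa using this)))
    · exact Or.inr (Or.inr (Or.inr (by simpa using this)))
    · exfalso; simp at hlen; grind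
  · have : L = T := by
      refine sorted_ext _ _ _ hL hTs ?_
      intro k
      by_cases hk : (k : ℕ) < r
      · have h1 : k ∉ L := fun h => hz ((hcnt' k z hk hrpos).1 h)
        have h2 : k ∉ T := fun h => by have := hTm k h; omega
        simp [h1, h2]
      · exact hTm2 k (by omega)
    have hlen : L.length = T.length := by rw [← this]
    by_cases h1 : p ∈ L <;> by_cases h2 : q ∈ L <;> simp only [T, h1, h2, if_true, if_false] at this hlen
    · exact Or.inr (Or.inl (by simpa using this))
    · exfalso; simp [hlen] at he
    · exfalso; simp [hlen] at he
    · exact Or.inl (by simpa using this)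

theorem lP_commute (n r : ℕ) (L : List (Fin n))
    (h : ∀ i j : Fin n, (i : ℕ) < r → (j : ℕ) < r → Even (L.count i + L.count j))
    (i j : Fin n) (hi : (i : ℕ) < r) (hj : (j : ℕ) < r) :
    Commute (lP n L) (gen n i * gen n j) := by
  have := gen2_mul_lP n i j L
  rw [Even.neg_one_pow (h i j hi hj), one_smul] at this
  exact this.symm

/-- For `r ≡ 5 (mod 8)`, the centralizer of `spin(r) = span{e_i e_j : i < j ≤ r}` in the
even Clifford algebra `Cl_{r+2}⁰` is the 4-dimensional span of `1`, `e_{r+1}e_{r+2}`,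
`e₁⋯e_{r+1}`, `e₁⋯e_r e_{r+2}`, and is isomorphic as an ℝ-algebra to the quaternions ℍ. -/
theorem stmt6 (r : ℕ) (hr : r % 8 = 5) :
    let n := r + 2
    let a : Cl n := gen n ⟨r, by omega⟩ * gen n ⟨r + 1, by omega⟩
    let b : Cl n := eProd n (Finset.univ.filter fun i => (i : ℕ) < r + 1)
    let c : Cl n := eProd n (Finset.univ.filter fun i => (i : ℕ) < r ∨ (i : ℕ) = r + 1)
    ({x : Cl n | x ∈ CliffordAlgebra.even (Qneg n) ∧
        ∀ i j : Fin n, (i : ℕ) < r → (j : ℕ) < r → i < j →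
          Commute x (gen n i * gen n j)} =
      (Submodule.span ℝ {1, a, b, c} : Set (Cl n))) ∧
    ∃ f : Quaternion ℝ →ₐ[ℝ] Cl n, Function.Injective f ∧
      Set.range f = (Submodule.span ℝ {1, a, b, c} : Set (Cl n)) := by
  intro n a b c
  have hodd : Odd r := by rw [Nat.odd_iff]; omega
  set p : Fin n := ⟨r, by omega⟩ with hp
  set q : Fin n := ⟨r + 1, by omega⟩ with hq
  have hpq : p ≠ q := by simp [hp, hq, Fin.ext_iff]
  have ha : a = lP n [p, q] := by simp only [lP_cons, lP_nil, mul_one]; rfl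
  have hb : b = lP n (wL r ++ [p]) := by
    rw [lP_eq_eProd _ _ (wL_append_sorted r _ (by simp) (by simp [hp]))]
    simp only [b]
    congr 1
    ext k
    simp only [Finset.mem_filter, Finset.mem_univ, true_and, List.mem_toFinset, List.mem_append,
      wL_mem, List.mem_singleton, Fin.ext_iff, hp]
    omega
  have hc : c = lP n (wL r ++ [q]) := by
    rw [lP_eq_eProd _ _ (wL_append_sorted r _ (by simp) (by simp [hq]))]
    simp only [c]
    congr 1
    ext k
    simp only [Finset.mem_filter, Finset.mem_univ, true_and, List.mem_toFinset, List.mem_append,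
      wL_mem, List.mem_singleton, Fin.ext_iff, hq]
  have hpw : p ∉ wL r := by rw [wL_mem]; simp [hp]
  have hqw : q ∉ wL r := by rw [wL_mem]; simp [hq]
  have hwnd : (wL r).Nodup := (wL_sorted r).imp fun h => ne_of_lt h
  have hcw : ∀ i : Fin n, (i : ℕ) < r → (wL r).count i = 1 := by
    intro i hi
    exact List.count_eq_one_of_mem hwnd ((wL_mem r i).2 hi)
  have hcp : ∀ i : Fin n, (i : ℕ) < r → p ≠ i := by
    intro i hi h
    rw [← h] at hi; simp [hp] at hi
  have hcq : ∀ i : Fin n, (i : ℕ) < r → q ≠ i := by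
    intro i hi h
    rw [← h] at hi; simp [hq] at hi
  refine ⟨?_, ?_⟩
  · apply Set.Subset.antisymm
    · rintro x ⟨hx, hxc⟩
      have := centralizer_sub n r x hx hxc
      refine Submodule.span_mono ?_ this
      rintro _ ⟨L, ⟨⟨hL, he⟩, hcm⟩, rfl⟩
      rcases classify r hodd p q rfl rfl L hL he hcm with rfl | rfl | rfl | rfl
      · simp [lP_nil]
      · exact Or.inr (Or.inl ha.symm)
      · exact Or.inr (Or.inr (Or.inl hb.symm))
      · exact Or.inr (Or.inr (Or.inr hc.symm))
    · intro x hx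
      rw [SetLike.mem_coe] at hx
      have hS : ∀ L : List (Fin n), Even L.length →
          (∀ i j : Fin n, (i : ℕ) < r → (j : ℕ) < r → Even (L.count i + L.count j)) →
          lP n L ∈ CliffordAlgebra.even (Qneg n) ∧
        ∀ i j : Fin n, (i : ℕ) < r → (j : ℕ) < r → i < j →
          Commute (lP n L) (gen n i * gen n j) := fun L h1 h2 =>
        ⟨lP_mem_even n L h1, fun i j hi hj _ => lP_commute n r L h2 i j hi hj⟩
      induction hx using Submodule.span_induction with
      | mem y hy =>
        rcases hy with rfl | rfl | rfl | rfl
        · exact ⟨Subalgebra.one_mem _, fun i j _ _ _ => Commute.one_left _⟩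
        · rw [ha]
          refine hS _ (by simp) ?_
          intro i j hi hj
          simp [List.count_cons, hcp i hi, hcq i hi, hcp j hj, hcq j hj]
        · rw [hb]
          refine hS _ (by simp [wL_len, Nat.even_add_one, hodd]) ?_
          intro i j hi hj
          simp [List.count_append, List.count_cons, hcw i hi, hcw j hj, hcp i hi, hcp j hj]
        · rw [hc]
          refine hS _ (by simp [wL_len, Nat.even_add_one, hodd]) ?_
          intro i j hi hj
          simp [List.count_append, List.count_cons, hcw i hi, hcw j hj, hcq i hi, hcq j hj]
      | zero => exact ⟨Subalgebra.zero_mem _, fun i j _ _ _ => Commute.zero_left _⟩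
      | add y z _ _ hy hz =>
        exact ⟨Subalgebra.add_mem _ hy.1 hz.1, fun i j h1 h2 h3 =>
          (hy.2 i j h1 h2 h3).add_left (hz.2 i j h1 h2 h3)⟩
      | smul s y _ hy =>
        exact ⟨Subalgebra.smul_mem _ hy.1 s, fun i j h1 h2 h3 =>
          (hy.2 i j h1 h2 h3).smul_left s⟩
  · have hW : lP n (wL r) * lP n (wL r) = -1 := by
      rw [lP_sq n _ hwnd, wL_len, Odd.neg_one_pow]
      · simp
      · rw [Nat.choose_two_right, Nat.add_sub_cancel]
        obtain ⟨m, rfl⟩ : ∃ m, r = 8 * m + 5 := ⟨r / 8, by omega⟩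
        have : (8 * m + 5 + 1) * (8 * m + 5) = 2 * (2 * (16 * m ^ 2 + 22 * m + 7) + 1) := by ring
        rw [this, Nat.mul_div_cancel_left _ (by norm_num)]
        exact ⟨_, rfl⟩
    have hb' : b = lP n (wL r) * gen n p := by rw [hb, lP_append]; simp [lP_cons, lP_nil]
    have hc' : c = lP n (wL r) * gen n q := by rw [hc, lP_append]; simp [lP_cons, lP_nil]
    have hpW : gen n p * lP n (wL r) = - (lP n (wL r) * gen n p) := by
      rw [gen_mul_lP, List.count_eq_zero_of_not_mem hpw, wL_len, add_zero, Odd.neg_one_pow hodd]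
      simp
    have hqW : gen n q * lP n (wL r) = - (lP n (wL r) * gen n q) := by
      rw [gen_mul_lP, List.count_eq_zero_of_not_mem hqw, wL_len, add_zero, Odd.neg_one_pow hodd]
      simp
    have hqp := gen_anti n q p hpq.symm
    have hpp := gen_sq n p
    have hqq := gen_sq n q
    have haa : a * a = -1 := gen2_sq n p q hpq
    have hbb : b * b = -1 := by
      rw [hb', mul_assoc, ← mul_assoc (gen n p), hpW, neg_mul, mul_assoc, hpp, mul_neg,
        mul_neg, mul_one, mul_neg, neg_neg, hW]
    have hab : a * b = c := by
      change gen n p * gen n q * b = c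
      rw [hb', hc', mul_assoc, ← mul_assoc (gen n q), hqW, neg_mul, mul_assoc, hqp, mul_neg, mul_neg,
        mul_neg, neg_neg, ← mul_assoc, hpW, neg_mul, mul_assoc, ← mul_assoc (gen n p), hpp]
      simp
    have hba : b * a = - c := by
      change b * (gen n p * gen n q) = - c
      rw [hb', hc', mul_assoc, ← mul_assoc (gen n p), hpp]
      simp
    let B : QuaternionAlgebra.Basis (Cl n) (-1 : ℝ) 0 (-1) :=
      { i := a, j := b, k := c
        i_mul_i := by rw [haa]; simp
        j_mul_j := by rw [hbb]; simp
        i_mul_j := hab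
        j_mul_i := by rw [hba]; simp }
    have hB : ∀ x : Quaternion ℝ, B.liftHom x
      = algebraMap ℝ (Cl n) x.re + x.imI • a + x.imJ • b + x.imK • c := fun x => rfl
    have : Invertible (2 : ℝ) := invertibleOfNonzero two_ne_zero
    have : Nontrivial (Cl n) := inferInstance
    let f : Quaternion ℝ →ₐ[ℝ] Cl n := B.liftHom
    refine ⟨f, f.toRingHom.injective, ?_⟩
    ext x
    simp only [Set.mem_range, SetLike.mem_coe, Submodule.mem_span_insert,
      Submodule.mem_span_singleton]
    constructor
    · rintro ⟨y, rfl⟩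
      refine ⟨y.re, _, ⟨y.imI, _, ⟨y.imJ, _, ⟨y.imK, rfl⟩, rfl⟩, rfl⟩, ?_⟩
      rw [show f y = _ from hB y, Algebra.algebraMap_eq_smul_one]
      abel
    · rintro ⟨s, _, ⟨t, _, ⟨u, _, ⟨v, rfl⟩, rfl⟩, rfl⟩, rfl⟩
      refine ⟨⟨s, t, u, v⟩, ?_⟩
      refine (hB _).trans ?_
      rw [Algebra.algebraMap_eq_smul_one]
      simp only [add_assoc]
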